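/- Let e = R_{e₁,e₀} + R_{e₂,e₃} ∈ so(V, β) (a nilpotent element of Jordan type (3,2²)). Then the centralizer of e in so(V, β) equals the ℂ-span of {R_{e₁,e₀}, R_{e₂,e₃}, R_{e₂,e₋₂} − R_{e₃,e₋₃}, R_{e₂,e₋₃}, R_{e₃,e₋₂}, 2·R_{e₁,e₋₃} + R_{e₂,e₀}, −2·R_{e₁,e₋₂} + R_{e₃,e₀}, R_{e₁,e₃}, R_{e₁,e₂}}; in particular it has dimension 9 over ℂ. -/

import Mathlib

noncomputable section

/-- `V = ℂ⁷` with ordered basis `(e₁, e₂, e₃, e₀, e₋₃, e₋₂, e₋₁)`. -/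
abbrev V7 : Type := Fin 7 → ℂ

/-- The Gram matrix of the symmetric bilinear form `β` in the ordered basis
`(e₁, e₂, e₃, e₀, e₋₃, e₋₂, e₋₁)`:  `β(eᵢ, e₋ᵢ) = β(e₋ᵢ, eᵢ) = 1`, `β(e₀,e₀) = 2`,
all other pairs `0`. -/
def Bmat : Matrix (Fin 7) (Fin 7) ℂ :=
  Matrix.of fun i j =>
    if (i : ℕ) + (j : ℕ) = 6 then (if (i : ℕ) = 3 then 2 else 1) else 0

/-- The symmetric bilinear form `β` on `V`. -/
def beta : V7 →ₗ[ℂ] V7 →ₗ[ℂ] ℂ := Matrix.toBilin' Bmat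

/-- `so(V, β) = {x ∈ End(V) : β(xu, w) + β(u, xw) = 0 for all u, w}`. -/
def so7 : Set (Module.End ℂ V7) :=
  {x | ∀ u w : V7, beta (x u) w + beta u (x w) = 0}

/-- `R_{u,w}(v) = β(w,v) • u − β(u,v) • w`. -/
def Rm (u w : V7) : Module.End ℂ V7 :=
  (beta w).smulRight u - (beta u).smulRight w

def e1 : V7 := Pi.single 0 1
def e2 : V7 := Pi.single 1 1
def e3 : V7 := Pi.single 2 1
def e0 : V7 := Pi.single 3 1
def em3 : V7 := Pi.single 4 1
def em2 : V7 := Pi.single 5 1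
def em1 : V7 := Pi.single 6 1

/-- The nilpotent element . -/
def eNil : Module.End ℂ V7 := Rm e1 e0 + Rm e2 e3

/-- The centralizer of  in . -/
def cent : Set (Module.End ℂ V7) := {x | x ∈ so7 ∧ x * eNil = eNil * x}

/-- The claimed spanning set. -/
def spanSet : Set (Module.End ℂ V7) := {Rm e1 e0, Rm e2 e3, Rm e2 em2 - Rm e3 em3, Rm e2 em3, Rm e3 em2, (2:ℂ) • Rm e1 em3 + Rm e2 e0, (-2:ℂ) • Rm e1 em2 + Rm e3 e0, Rm e1 e3, Rm e1 e2}

theorem beta_apply (u w : V7) :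
    beta u w = u 0 * w 6 + u 1 * w 5 + u 2 * w 4 + 2 * u 3 * w 3 + u 4 * w 2 + u 5 * w 1
      + u 6 * w 0 := by
  simp [beta, Matrix.toBilin'_apply, Bmat, Fin.sum_univ_succ]
  ring

theorem Rm_apply (u w v : V7) (i : Fin 7) :
    Rm u w v i = beta w v * u i - beta u v * w i := by
  simp [Rm]

theorem Rm_mem_so7 (u w : V7) : Rm u w ∈ so7 := by
  intro a b
  simp only [beta_apply, Rm_apply]
  ring

/-- `so(V, β)` as a submodule of `End(V)`. -/
def so7Submodule : Submodule ℂ (Module.End ℂ V7) where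
  carrier := so7
  zero_mem' := fun u w => by simp
  add_mem' := fun {x y} hx hy u w => by
    have h₁ := hx u w
    have h₂ := hy u w
    simp only [LinearMap.add_apply, map_add]
    linear_combination h₁ + h₂
  smul_mem' := fun c x hx u w => by
    have h := hx u w
    simp only [LinearMap.smul_apply, map_smul, smul_eq_mul]
    linear_combination c * h

/-- The centralizer of `eNil` as a submodule of `End(V)`. -/
def centSubmodule : Submodule ℂ (Module.End ℂ V7) :=
  so7Submodule ⊓ (Subalgebra.centralizer ℂ {eNil}).toSubmodule

theorem coe_centSubmodule : (centSubmodule : Set (Module.End ℂ V7)) = cent := by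
  ext x
  simp only [centSubmodule, cent, Submodule.coe_inf, Set.mem_inter_iff, SetLike.mem_coe,
    Subalgebra.mem_toSubmodule, Subalgebra.mem_centralizer_iff, Set.mem_singleton_iff, forall_eq,
    Set.mem_ofPred_eq, eq_comm (a := x * eNil)]
  rfl

/-- The generators listed in `spanSet`, as an indexed family. -/
def generator : Fin 9 → Module.End ℂ V7 :=
  ![Rm e1 e0, Rm e2 e3, Rm e2 em2 - Rm e3 em3, Rm e2 em3, Rm e3 em2,
    (2 : ℂ) • Rm e1 em3 + Rm e2 e0, (-2 : ℂ) • Rm e1 em2 + Rm e3 e0, Rm e1 e3, Rm e1 e2]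

theorem range_generator : Set.range generator = spanSet := by
  simp only [generator, Matrix.range_cons, Matrix.range_empty, Set.union_empty, spanSet,
    Set.singleton_union]

theorem eNil_apply (v : V7) :
    eNil v = ![2 * v 3, v 4, - v 5, - v 6, 0, 0, 0] := by
  ext i
  fin_cases i <;>
    simp [eNil, Rm_apply, beta_apply, e1, e2, e3, e0]

theorem eNil_e1 : eNil e1 = 0 := by ext i; fin_cases i <;> simp [eNil_apply, e1]

theorem eNil_e2 : eNil e2 = 0 := by ext i; fin_cases i <;> simp [eNil_apply, e2]

theorem eNil_e3 : eNil e3 = 0 := by ext i; fin_cases i <;> simp [eNil_apply, e3]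

theorem eNil_e0 : eNil e0 = (2 : ℂ) • e1 := by
  ext i; fin_cases i <;> simp [eNil_apply, e0, e1]

theorem eNil_em3 : eNil em3 = e2 := by ext i; fin_cases i <;> simp [eNil_apply, em3, e2]

theorem eNil_em2 : eNil em2 = -e3 := by ext i; fin_cases i <;> simp [eNil_apply, em2, e3]

theorem eNil_em1 : eNil em1 = -e0 := by ext i; fin_cases i <;> simp [eNil_apply, em1, e0]

/-- Every `y ∈ so(V, β)` acts on the operators `R_{u,w}` as a derivation in `u` and `w`. -/
theorem mul_Rm_sub_Rm_mul {y : Module.End ℂ V7} (hy : y ∈ so7) (u w : V7) :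
    y * Rm u w - Rm u w * y = Rm (y u) w + Rm u (y w) := by
  refine LinearMap.ext fun v => ?_
  have h₁ := eq_neg_of_add_eq_zero_left (hy w v)
  have h₂ := eq_neg_of_add_eq_zero_left (hy u v)
  simp only [LinearMap.sub_apply, LinearMap.add_apply, Module.End.mul_apply, Rm,
    LinearMap.smulRight_apply, map_sub, map_smul, h₁, h₂]
  module

theorem generator_mem_cent (i : Fin 9) : generator i ∈ cent := by
  have hR (u w) : Rm u w ∈ so7Submodule := Rm_mem_so7 u w
  have hso : generator i ∈ so7Submodule := by
    fin_cases i
    · exact hR _ _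
    · exact hR _ _
    · exact sub_mem (hR _ _) (hR _ _)
    · exact hR _ _
    · exact hR _ _
    · exact add_mem (Submodule.smul_mem _ _ (hR _ _)) (hR _ _)
    · exact add_mem (Submodule.smul_mem _ _ (hR _ _)) (hR _ _)
    · exact hR _ _
    · exact hR _ _
  refine ⟨hso, ?_⟩
  have he : eNil ∈ so7 := add_mem (hR e1 e0) (hR e2 e3)
  have hcomm (u w) : eNil * Rm u w = Rm u w * eNil + (Rm (eNil u) w + Rm u (eNil w)) :=
    eq_add_of_sub_eq' (mul_Rm_sub_Rm_mul he u w)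
  ext v j
  fin_cases i <;>
  · simp [generator, mul_add, add_mul, mul_sub, sub_mul, hcomm, eNil_e1, eNil_e2, eNil_e3,
      eNil_e0, eNil_em3, eNil_em2, Rm_apply, -Module.End.mul_apply]
    try ring

theorem sum_smul_generator_apply (c : Fin 9 → ℂ) (v : V7) :
    (∑ k, c k • generator k) v =
      ![2 * c 0 * v 3 + 2 * c 5 * v 2 - 2 * c 6 * v 1 + c 7 * v 4 + c 8 * v 5,
        c 1 * v 4 + c 2 * v 1 + c 3 * v 2 + 2 * c 5 * v 3 - c 8 * v 6,
        -c 1 * v 5 - c 2 * v 2 + c 4 * v 1 + 2 * c 6 * v 3 - c 7 * v 6,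
        -c 0 * v 6 - c 5 * v 5 - c 6 * v 4,
        c 2 * v 4 - c 3 * v 5 - 2 * c 5 * v 6,
        -c 2 * v 5 - c 4 * v 4 + 2 * c 6 * v 6,
        0] := by
  have hsum (i : Fin 7) : (∑ k, c k • generator k) v i = ∑ k, c k * generator k v i := by
    simp
  ext i
  rw [hsum, Fin.sum_univ_castSucc, Fin.sum_univ_eight]
  simp only [generator, Fin.reduceCastSucc, Fin.reduceLast, Matrix.cons_val,
    LinearMap.add_apply, LinearMap.sub_apply, LinearMap.smul_apply, Pi.add_apply, Pi.sub_apply, Pi.smul_apply, smul_eq_mul, Rm_apply,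
    beta_apply, e1, e2, e3, e0, em2, em3]
  fin_cases i <;>
  · simp
    try ring

theorem linearIndependent_generator : LinearIndependent ℂ generator := by
  rw [Fintype.linearIndependent_iff]
  intro c hc
  have h (j i : Fin 7) : (∑ k, c k • generator k) (Pi.single j 1) i = 0 := by rw [hc]; rfl
  simp only [sum_smul_generator_apply] at h
  intro i
  fin_cases i
  · simpa using h 6 3
  · simpa using h 4 1
  · simpa using h 1 1
  · simpa using h 2 1
  · simpa using h 1 2
  · simpa using h 3 1
  · simpa using h 3 2
  · simpa using h 4 0
  · simpa using h 5 0

theorem eq_sum_generator_of_mem_cent {x : Module.End ℂ V7} (hx : x ∈ cent) :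
    x = ∑ k, (![-x em1 3, x em3 1, x e2 1, x e3 1, x e2 2, x e0 1 / 2, x e0 2 / 2,
      x em3 0, x em2 0] : Fin 9 → ℂ) k • generator k := by
  obtain ⟨hso, hcomm⟩ := hx
  have hc (v : V7) (i : Fin 7) : x (eNil v) i = eNil (x v) i :=
    congrFun (LinearMap.congr_fun hcomm v) i
  have c1 := hc e1
  have c2 := hc e2
  have c3 := hc e3
  have c0 := hc e0
  have cm3 := hc em3
  have cm2 := hc em2
  have cm1 := hc em1
  rw [eNil_e1, map_zero, eNil_apply] at c1
  rw [eNil_e2, map_zero, eNil_apply] at c2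
  rw [eNil_e3, map_zero, eNil_apply] at c3
  rw [eNil_e0, map_smul, eNil_apply] at c0
  rw [eNil_em3, eNil_apply] at cm3
  rw [eNil_em2, map_neg, eNil_apply] at cm2
  rw [eNil_em1, map_neg, eNil_apply] at cm1
  have hs (i j : Fin 7) := hso (Pi.single i 1) (Pi.single j 1)
  refine (Pi.basisFun ℂ (Fin 7)).ext fun j => funext fun i => ?_
  rw [sum_smul_generator_apply, Pi.basisFun_apply]
  simp [Fin.forall_fin_succ, e1, e2, e3, e0, em3, em2, em1] at c1 c2 c3 c0 cm3 cm2 cm1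
  simp [Fin.forall_fin_succ, beta_apply] at hs
  clear hc hcomm hso
  simp only [e2, e3, e0, em3, em2, em1, Matrix.cons_val]
  generalize hX : (fun i j : Fin 7 => x (Pi.single j 1) i) = X
  have hX' (i j : Fin 7) : x (Pi.single j 1) i = X i j := by rw [← hX]
  simp only [hX'] at *
  clear hX hX'
  fin_cases j <;> fin_cases i <;> simp <;> grind

theorem statement4 :
    cent = ↑(Submodule.span ℂ spanSet) ∧
      Module.finrank ℂ ↥(Submodule.span ℂ spanSet) = 9 := by
  rw [← range_generator]
  refine ⟨subset_antisymm (fun x hx => ?_) ?_, ?_⟩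
  · rw [eq_sum_generator_of_mem_cent hx]
    exact sum_mem fun k _ => Submodule.smul_mem _ _ (Submodule.subset_span ⟨k, rfl⟩)
  · rw [← coe_centSubmodule, SetLike.coe_subset_coe, Submodule.span_le, coe_centSubmodule]
    rintro _ ⟨k, rfl⟩
    exact generator_mem_cent k
  · simpa using finrank_span_eq_card linearIndependent_generator
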